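/- Let μ, T, dt > 0, let P be a smooth probability density on ℝ^d, let F, ν : ℝ^d → ℝ^d be smooth vector fields, and let φ : ℝ^d → ℝ be smooth with ν* := ∇φ satisfying ∇·((ν − ν*)·P) = 0 and φ·(ν − ν*)·P compactly supported, with ∫‖ν‖²P dx and ∫‖ν*‖²P dx finite. For a vector field v define the joint density ℙ¹_v(y,x) = g_v(y|x)·P(x), where g_v(·|x) is the Gaussian density with mean x + μF(x)·dt + v(x)·dt and covariance 2μT·dt·Id. Then: 4·D_KL(ℙ¹_ν ‖ ℙ¹_0)/dt = σ := (1/(μT))∫‖ν‖²P dx; 4·D_KL(ℙ¹_ν ‖ ℙ¹_{ν−ν*})/dt = 4·D_KL(ℙ¹_{ν*} ‖ ℙ¹_0)/dt = σ^ex := (1/(μT))∫‖ν*‖²P dx; and 4·D_KL(ℙ¹_ν ‖ ℙ¹_{ν*})/dt = 4·D_KL(ℙ¹_{ν−ν*} ‖ ℙ¹_0)/dt = σ^hk := (1/(μT))∫‖ν − ν*‖²P dx. -/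

import Mathlib

open MeasureTheory

/-- KL divergence between two densities `p, q` with respect to a measure `μ`. -/
noncomputable def KL {α : Type*} [MeasurableSpace α] (μ : Measure α) (p q : α → ℝ) : ℝ :=
  ∫ x, p x * Real.log (p x / q x) ∂μ

/-- The Gaussian density on `ℝ^d` with mean `m` and covariance `s·Id`. -/
noncomputable def gaussDensity {d : ℕ} (m : EuclideanSpace ℝ (Fin d)) (s : ℝ)
    (y : EuclideanSpace ℝ (Fin d)) : ℝ :=
  (2 * Real.pi * s) ^ (-(d : ℝ) / 2) * Real.exp (-‖y - m‖ ^ 2 / (2 * s))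

/-- Divergence of a vector field on `ℝ^d`. -/
noncomputable def diverg {d : ℕ}
    (u : EuclideanSpace ℝ (Fin d) → EuclideanSpace ℝ (Fin d))
    (x : EuclideanSpace ℝ (Fin d)) : ℝ :=
  ∑ i, fderiv ℝ (fun y => u y i) x (EuclideanSpace.single i 1)

lemma exp_norm_integrable {d : ℕ} {b : ℝ} (hb : 0 < b) :
    Integrable (fun z : EuclideanSpace ℝ (Fin d) => Real.exp (-b * ‖z‖ ^ 2)) := by
  by_contra h
  have h1 := GaussianFourier.integral_rexp_neg_mul_sq_norm (V := EuclideanSpace ℝ (Fin d)) hb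
  rw [integral_undef h] at h1
  have : 0 < (Real.pi / b) ^ (Module.finrank ℝ (EuclideanSpace ℝ (Fin d)) / 2 : ℝ) := by
    positivity
  linarith

lemma gauss_eq {d : ℕ} (s : ℝ) (z : EuclideanSpace ℝ (Fin d)) :
    gaussDensity 0 s z =
      (2 * Real.pi * s) ^ (-(d : ℝ) / 2) * Real.exp (-(1 / (2 * s)) * ‖z‖ ^ 2) := by
  unfold gaussDensity
  rw [sub_zero]
  congr 2
  ring

lemma gauss_integrable {d : ℕ} {s : ℝ} (hs : 0 < s) :
    Integrable (fun z : EuclideanSpace ℝ (Fin d) => gaussDensity 0 s z) := by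
  simp_rw [gauss_eq]
  exact (exp_norm_integrable (by positivity)).const_mul _

lemma gauss_integral {d : ℕ} {s : ℝ} (hs : 0 < s) :
    ∫ z : EuclideanSpace ℝ (Fin d), gaussDensity 0 s z = 1 := by
  simp_rw [gauss_eq]
  rw [integral_const_mul, GaussianFourier.integral_rexp_neg_mul_sq_norm (by positivity)]
  have : Real.pi / (1 / (2 * s)) = 2 * Real.pi * s := by field_simp
  rw [this, finrank_euclideanSpace_fin, ← Real.rpow_add (by positivity)]
  rw [show -(d : ℝ) / 2 + d / 2 = 0 by ring, Real.rpow_zero]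

lemma gauss_continuous {d : ℕ} (s : ℝ) :
    Continuous (fun z : EuclideanSpace ℝ (Fin d) => gaussDensity 0 s z) := by
  unfold gaussDensity
  fun_prop

lemma gauss_pos {d : ℕ} {s : ℝ} (hs : 0 < s) (m z : EuclideanSpace ℝ (Fin d)) :
    0 < gaussDensity m s z := by
  unfold gaussDensity
  positivity

lemma gauss_sq_integrable {d : ℕ} {s : ℝ} (hs : 0 < s) :
    Integrable (fun z : EuclideanSpace ℝ (Fin d) => ‖z‖ ^ 2 * gaussDensity 0 s z) := by
  have h := (exp_norm_integrable (d := d) (b := 1 / (4 * s)) (by positivity)).const_mul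
    ((2 * Real.pi * s) ^ (-(d : ℝ) / 2) * (4 * s))
  refine h.mono' ?_ (Filter.Eventually.of_forall fun z => ?_)
  · exact (((continuous_norm.pow 2).mul (gauss_continuous s))).aestronglyMeasurable
  · rw [Real.norm_of_nonneg (mul_nonneg (by positivity) (gauss_pos hs _ _).le), gauss_eq]
    have h1 := Real.add_one_le_exp (1 / (4 * s) * ‖z‖ ^ 2)
    have h2 : ‖z‖ ^ 2 ≤ 4 * s * Real.exp (1 / (4 * s) * ‖z‖ ^ 2) := by
      calc ‖z‖ ^ 2 = 4 * s * (1 / (4 * s) * ‖z‖ ^ 2) := by field_simp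
        _ ≤ _ := by gcongr; linarith
    have h3 : Real.exp (-(1 / (4 * s)) * ‖z‖ ^ 2) =
        Real.exp (1 / (4 * s) * ‖z‖ ^ 2) * Real.exp (-(1 / (2 * s)) * ‖z‖ ^ 2) := by
      rw [← Real.exp_add]; congr 1; field_simp; ring
    rw [h3]
    have h4 : 0 ≤ (2 * Real.pi * s) ^ (-(d : ℝ) / 2) *
        Real.exp (-(1 / (2 * s)) * ‖z‖ ^ 2) := by positivity
    nlinarith [mul_le_mul_of_nonneg_right h2 h4]

lemma log_ratio {d : ℕ} {s : ℝ} (hs : 0 < s) (A B z : EuclideanSpace ℝ (Fin d)) (p : ℝ) :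
    (gaussDensity A s (z + A) * p) *
      Real.log ((gaussDensity A s (z + A) * p) / (gaussDensity B s (z + A) * p)) =
    1 / s * (p * gaussDensity 0 s z * inner ℝ z (A - B)) +
      1 / (2 * s) * (‖A - B‖ ^ 2 * p * gaussDensity 0 s z) := by
  have h0 : gaussDensity A s (z + A) = gaussDensity 0 s z := by
    unfold gaussDensity; simp
  by_cases hp : p = 0
  · simp [hp]
  have hlog : Real.log ((gaussDensity A s (z + A) * p) / (gaussDensity B s (z + A) * p)) =
      (2 * inner ℝ z (A - B) + ‖A - B‖ ^ 2) / (2 * s) := by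
    rw [mul_div_mul_right _ _ hp]
    unfold gaussDensity
    rw [mul_div_mul_left _ _ (by positivity), ← Real.exp_sub, Real.log_exp]
    rw [show z + A - B = z + (A - B) by abel, norm_add_sq_real, add_sub_cancel_right]
    field_simp
    ring
  rw [hlog, h0]
  field_simp

lemma kl_gauss {d : ℕ} {s : ℝ} (hs : 0 < s) {P : EuclideanSpace ℝ (Fin d) → ℝ}
    (hPc : Continuous P) (hP0 : ∀ x, 0 ≤ P x) (hPi : Integrable P)
    {A B : EuclideanSpace ℝ (Fin d) → EuclideanSpace ℝ (Fin d)}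
    (hA : Continuous A) (hB : Continuous B)
    (hAB : Integrable (fun x => ‖A x - B x‖ ^ 2 * P x)) :
    KL volume (fun p : EuclideanSpace ℝ (Fin d) × EuclideanSpace ℝ (Fin d) =>
        gaussDensity (A p.2) s p.1 * P p.2)
      (fun p => gaussDensity (B p.2) s p.1 * P p.2) =
    1 / (2 * s) * ∫ x, ‖A x - B x‖ ^ 2 * P x := by
  unfold KL
  have hshear : MeasurePreserving
      (fun p : EuclideanSpace ℝ (Fin d) × EuclideanSpace ℝ (Fin d) => (p.1, p.2 + A p.1))
      (volume.prod volume) (volume.prod volume) := by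
    refine MeasurePreserving.skew_product (MeasurePreserving.id _)
      (g := fun x z => z + A x) ?_ (Filter.Eventually.of_forall fun x => ?_)
    · exact Continuous.measurable (by unfold Function.uncurry; fun_prop)
    · exact (measurePreserving_add_right volume (A x)).map_eq
  have hemb : MeasurableEmbedding
      (fun p : EuclideanSpace ℝ (Fin d) × EuclideanSpace ℝ (Fin d) => (p.1, p.2 + A p.1)) := by
    let e : (EuclideanSpace ℝ (Fin d) × EuclideanSpace ℝ (Fin d)) ≃ₜ
        (EuclideanSpace ℝ (Fin d) × EuclideanSpace ℝ (Fin d)) :=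
      { toFun := fun p => (p.1, p.2 + A p.1)
        invFun := fun p => (p.1, p.2 - A p.1)
        left_inv := fun p => by simp
        right_inv := fun p => by simp
        continuous_toFun := by fun_prop
        continuous_invFun := by fun_prop }
    exact e.measurableEmbedding
  rw [Measure.volume_eq_prod, ← integral_prod_swap, ← hshear.integral_comp hemb]
  simp only [Prod.fst_swap, Prod.snd_swap]
  simp_rw [log_ratio hs]
  have hG := gauss_integrable (d := d) hs
  have I2 : Integrable (fun p : EuclideanSpace ℝ (Fin d) × EuclideanSpace ℝ (Fin d) =>
      ‖A p.1 - B p.1‖ ^ 2 * P p.1 * gaussDensity 0 s p.2) (volume.prod volume) :=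
    hAB.mul_prod hG
  have I3 : Integrable (fun p : EuclideanSpace ℝ (Fin d) × EuclideanSpace ℝ (Fin d) =>
      P p.1 * (‖p.2‖ ^ 2 * gaussDensity 0 s p.2)) (volume.prod volume) :=
    hPi.mul_prod (gauss_sq_integrable hs)
  have I1 : Integrable (fun p : EuclideanSpace ℝ (Fin d) × EuclideanSpace ℝ (Fin d) =>
      P p.1 * gaussDensity 0 s p.2 * inner ℝ p.2 (A p.1 - B p.1)) (volume.prod volume) := by
    refine (I2.add I3).mono' ?_ (Filter.Eventually.of_forall fun p => ?_)
    · have := gauss_continuous (d := d) s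
      exact Continuous.aestronglyMeasurable (by fun_prop)
    · have hg := (gauss_pos hs 0 p.2).le
      have hc : 0 ≤ P p.1 * gaussDensity 0 s p.2 := mul_nonneg (hP0 _) hg
      rw [norm_mul, Real.norm_of_nonneg hc]
      have h1 := norm_inner_le_norm (𝕜 := ℝ) p.2 (A p.1 - B p.1)
      have h2 : ‖p.2‖ * ‖A p.1 - B p.1‖ ≤ ‖A p.1 - B p.1‖ ^ 2 + ‖p.2‖ ^ 2 := by
        nlinarith [sq_nonneg (‖p.2‖ - ‖A p.1 - B p.1‖), sq_nonneg ‖p.2‖,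
          sq_nonneg ‖A p.1 - B p.1‖]
      have h3 := mul_le_mul_of_nonneg_left (h1.trans h2) hc
      simp only [Pi.add_apply]
      linarith
  rw [integral_add (I1.const_mul _) (I2.const_mul _), integral_const_mul, integral_const_mul]
  have hodd : ∫ p : EuclideanSpace ℝ (Fin d) × EuclideanSpace ℝ (Fin d),
      P p.1 * gaussDensity 0 s p.2 * inner ℝ p.2 (A p.1 - B p.1) ∂(volume.prod volume) = 0 := by
    rw [integral_prod _ I1]
    refine integral_eq_zero_of_ae (Filter.Eventually.of_forall fun x => ?_)
    have h := integral_neg_eq_self (fun z : EuclideanSpace ℝ (Fin d) =>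
      P x * gaussDensity 0 s z * inner ℝ z (A x - B x)) volume
    have hn : ∀ z : EuclideanSpace ℝ (Fin d), gaussDensity 0 s (-z) = gaussDensity 0 s z := by
      intro z; unfold gaussDensity; simp
    simp only [hn, inner_neg_left, mul_neg, integral_neg] at h
    simp only [Pi.zero_apply]
    linarith
  have hmain := integral_prod_mul (μ := (volume : Measure (EuclideanSpace ℝ (Fin d))))
    (ν := (volume : Measure (EuclideanSpace ℝ (Fin d))))
    (fun x => ‖A x - B x‖ ^ 2 * P x) (fun z => gaussDensity 0 s z)
  rw [hodd, hmain, gauss_integral hs]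
  ring

/-- **Entropy production rates as KL divergences between path probability densities.**
For a vector field `v`, let `ℙ¹_v(y,x) = g_v(y|x)P(x)` with `g_v(·|x)` Gaussian with
mean `x + μF(x)dt + v(x)dt` and covariance `2μT·dt·Id`. With `ν* = ∇φ`,
`∇·((ν−ν*)P) = 0` and `φ(ν−ν*)P` compactly supported:
`4·D_KL(ℙ¹_ν‖ℙ¹_0)/dt = σ`, `4·D_KL(ℙ¹_ν‖ℙ¹_{ν−ν*})/dt = 4·D_KL(ℙ¹_{ν*}‖ℙ¹_0)/dt = σ^ex`,
and `4·D_KL(ℙ¹_ν‖ℙ¹_{ν*})/dt = 4·D_KL(ℙ¹_{ν−ν*}‖ℙ¹_0)/dt = σ^hk`. -/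
theorem entropy_productions_as_path_kl {d : ℕ} (μ T dt : ℝ)
    (hμ : 0 < μ) (hT : 0 < T) (hdt : 0 < dt)
    (P : EuclideanSpace ℝ (Fin d) → ℝ)
    (hP : ContDiff ℝ (⊤ : ℕ∞) P) (hPnonneg : ∀ x, 0 ≤ P x) (hPone : (∫ x, P x) = 1)
    (F ν : EuclideanSpace ℝ (Fin d) → EuclideanSpace ℝ (Fin d))
    (hF : ContDiff ℝ (⊤ : ℕ∞) F) (hν : ContDiff ℝ (⊤ : ℕ∞) ν)
    (φ : EuclideanSpace ℝ (Fin d) → ℝ) (hφ : ContDiff ℝ (⊤ : ℕ∞) φ)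
    (νstar : EuclideanSpace ℝ (Fin d) → EuclideanSpace ℝ (Fin d))
    (hνstar : ∀ x, νstar x = gradient φ x)
    (hzerodiv : ∀ x, diverg (fun y => P y • (ν y - νstar y)) x = 0)
    (hsupp : HasCompactSupport (fun x => φ x • (P x • (ν x - νstar x))))
    (hν2 : Integrable (fun x => ‖ν x‖ ^ 2 * P x))
    (hνstar2 : Integrable (fun x => ‖νstar x‖ ^ 2 * P x))
    (PJ : (EuclideanSpace ℝ (Fin d) → EuclideanSpace ℝ (Fin d)) →
      (EuclideanSpace ℝ (Fin d) × EuclideanSpace ℝ (Fin d) → ℝ))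
    (hPJ : ∀ v p, PJ v p =
      gaussDensity (p.2 + (μ * dt) • F p.2 + dt • v p.2) (2 * μ * T * dt) p.1 * P p.2)
    (σ σex σhk : ℝ)
    (hσ : σ = (1 / (μ * T)) * ∫ x, ‖ν x‖ ^ 2 * P x)
    (hσex : σex = (1 / (μ * T)) * ∫ x, ‖νstar x‖ ^ 2 * P x)
    (hσhk : σhk = (1 / (μ * T)) * ∫ x, ‖ν x - νstar x‖ ^ 2 * P x) :
    4 * KL volume (PJ ν) (PJ (fun _ => 0)) / dt = σ ∧
    4 * KL volume (PJ ν) (PJ (fun x => ν x - νstar x)) / dt = σex ∧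
    4 * KL volume (PJ νstar) (PJ (fun _ => 0)) / dt = σex ∧
    4 * KL volume (PJ ν) (PJ νstar) / dt = σhk ∧
    4 * KL volume (PJ (fun x => ν x - νstar x)) (PJ (fun _ => 0)) / dt = σhk := by
  have hPi : Integrable P := by
    by_contra h
    rw [integral_undef h] at hPone
    exact zero_ne_one hPone
  have hνs : Continuous νstar := by
    have h : νstar = fun x => (InnerProductSpace.toDual ℝ (EuclideanSpace ℝ (Fin d))).symm
        (fderiv ℝ φ x) := funext hνstar
    rw [h]
    exact (LinearIsometryEquiv.continuous _).comp (hφ.continuous_fderiv (by simp))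
  have hνc := hν.continuous
  have hFc := hF.continuous
  have hPc := hP.continuous
  have hdiff : Integrable (fun x => ‖ν x - νstar x‖ ^ 2 * P x) := by
    refine ((hν2.const_mul 2).add (hνstar2.const_mul 2)).mono' ?_
      (Filter.Eventually.of_forall fun x => ?_)
    · exact Continuous.aestronglyMeasurable (by fun_prop)
    · rw [Real.norm_of_nonneg (mul_nonneg (by positivity) (hPnonneg x))]
      have h1 := parallelogram_law_with_norm ℝ (ν x) (νstar x)
      have h2 : ‖ν x - νstar x‖ ^ 2 ≤ 2 * ‖ν x‖ ^ 2 + 2 * ‖νstar x‖ ^ 2 := by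
        nlinarith [sq_nonneg ‖ν x + νstar x‖]
      have h3 := mul_le_mul_of_nonneg_right h2 (hPnonneg x)
      simp only [Pi.add_apply]
      linarith
  have key : ∀ a b c : EuclideanSpace ℝ (Fin d) → EuclideanSpace ℝ (Fin d),
      Continuous a → Continuous b → (∀ x, a x - b x = c x) →
      Integrable (fun x => ‖c x‖ ^ 2 * P x) →
      4 * KL volume (PJ a) (PJ b) / dt = (1 / (μ * T)) * ∫ x, ‖c x‖ ^ 2 * P x := by
    intro a b c ha hb hc hi
    have hs : 0 < 2 * μ * T * dt := by positivity
    have hsub : ∀ x, ‖(x + (μ * dt) • F x + dt • a x) - (x + (μ * dt) • F x + dt • b x)‖ ^ 2 * P x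
        = dt ^ 2 * (‖c x‖ ^ 2 * P x) := by
      intro x
      rw [add_sub_add_left_eq_sub, ← smul_sub, hc, norm_smul, Real.norm_of_nonneg hdt.le]
      ring
    have h := kl_gauss hs hPc hPnonneg hPi
      (A := fun x => x + (μ * dt) • F x + dt • a x)
      (B := fun x => x + (μ * dt) • F x + dt • b x) (by fun_prop) (by fun_prop)
      (by simp_rw [hsub]; exact hi.const_mul _)
    simp_rw [hsub] at h
    rw [integral_const_mul] at h
    rw [funext (hPJ a), funext (hPJ b), h]
    field_simp
    ring
  have h0 : Continuous (fun _ : EuclideanSpace ℝ (Fin d) => (0 : EuclideanSpace ℝ (Fin d))) :=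
    continuous_const
  rw [hσ, hσex, hσhk]
  exact ⟨key _ _ _ hνc h0 (fun x => sub_zero _) hν2,
    key _ _ _ hνc (hνc.sub hνs) (fun x => sub_sub_cancel _ _) hνstar2,
    key _ _ _ hνs h0 (fun x => sub_zero _) hνstar2,
    key _ _ (fun x => ν x - νstar x) hνc hνs (fun x => rfl) hdiff,
    key _ _ (fun x => ν x - νstar x) (hνc.sub hνs) h0 (fun x => sub_zero _) hdiff⟩
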